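/- The algebra S_n is neither left Noetherian nor right Noetherian; moreover S_n contains an infinite direct sum of nonzero left ideals and an infinite direct sum of nonzero right ideals. -/

import Mathlib

set_option synthInstance.maxHeartbeats 1000000
set_option maxHeartbeats 1000000

open MvPolynomial

noncomputable section

/-- The polynomial algebra `P_n = K[x_1, …, x_n]`. -/
abbrev PolyAlg (K : Type u) [Field K] (n : ℕ) := MvPolynomial (Fin n) K

/-- `X_i` : multiplication by the variable `x_i`, as a `K`-linear endomorphism of `P_n`. -/
def Xop (K : Type u) [Field K] (n : ℕ) (i : Fin n) : Module.End K (PolyAlg K n) :=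
  LinearMap.mulLeft K (X i)

/-- `Y_i` : the left inverse of `X_i`, sending a monomial `x^α` to `x^{α - e_i}` if `α i ≥ 1`
and to `0` otherwise. -/
def Yop (K : Type u) [Field K] (n : ℕ) (i : Fin n) : Module.End K (PolyAlg K n) :=
  (basisMonomials (Fin n) K).constr K fun α =>
    if α i = 0 then 0 else monomial (α - Finsupp.single i 1) (1 : K)

/-- The algebra `S_n` of one-sided inverses of `P_n` : the subalgebra of `End_K(P_n)`
generated by `X_1, …, X_n, Y_1, …, Y_n`. -/
def SnAlg (K : Type u) [Field K] (n : ℕ) : Subalgebra K (Module.End K (PolyAlg K n)) :=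
  Algebra.adjoin K (Set.range (Xop K n) ∪ Set.range (Yop K n))

/-- `x_i` as an element of `S_n`. -/
def xS (K : Type u) [Field K] (n : ℕ) (i : Fin n) : SnAlg K n :=
  ⟨Xop K n i, Algebra.subset_adjoin (Set.mem_union_left _ ⟨i, rfl⟩)⟩

/-- `y_i` as an element of `S_n`. -/
def yS (K : Type u) [Field K] (n : ℕ) (i : Fin n) : SnAlg K n :=
  ⟨Yop K n i, Algebra.subset_adjoin (Set.mem_union_right _ ⟨i, rfl⟩)⟩

/-- The product `I*J` of two two-sided ideals: the two-sided ideal generated by all products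
`a * b` with `a ∈ I`, `b ∈ J`. -/
def tsiMul {R : Type*} [Ring R] (I J : TwoSidedIdeal R) : TwoSidedIdeal R :=
  TwoSidedIdeal.span {x | ∃ a ∈ I, ∃ b ∈ J, x = a * b}

/-- A two-sided ideal `P` of a ring is prime if it is proper and for all two-sided ideals
`I`, `J`, `I*J ⊆ P` implies `I ⊆ P` or `J ⊆ P`. -/
def tsiPrime {R : Type*} [Ring R] (P : TwoSidedIdeal R) : Prop :=
  P ≠ ⊤ ∧ ∀ I J : TwoSidedIdeal R, tsiMul I J ≤ P → I ≤ P ∨ J ≤ P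

/-- The ranges of pairwise orthogonal idempotent endomorphisms of a module are independent. -/
theorem iSupIndep_range_of_orthogonalIdempotents {R M ι : Type*} [Ring R] [AddCommGroup M]
    [Module R M] {φ : ι → Module.End R M} (hφ : OrthogonalIdempotents φ) :
    iSupIndep fun i => LinearMap.range (φ i) := by
  intro i
  have hle : (⨆ j, ⨆ (_ : j ≠ i), LinearMap.range (φ j)) ≤ LinearMap.ker (φ i) := by
    refine iSup₂_le fun j hj => ?_
    rintro _ ⟨m, rfl⟩
    exact LinearMap.congr_fun (hφ.ortho hj.symm) m
  refine Disjoint.mono_right hle (Submodule.disjoint_def.2 ?_)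
  rintro _ ⟨m, rfl⟩ hm
  exact (LinearMap.congr_fun (hφ.idem i) m).symm.trans hm

/-- Nonzero pairwise orthogonal idempotents generate independent nonzero left ideals. -/
theorem exists_iSupIndep_leftIdeals {R : Type*} [Ring R] {e : ℕ → R}
    (he : OrthogonalIdempotents e) (h0 : ∀ i, e i ≠ 0) :
    ∃ f : ℕ → Submodule R R, (∀ i, f i ≠ ⊥) ∧ iSupIndep f := by
  refine ⟨_, fun i h => h0 i ?_, iSupIndep_range_of_orthogonalIdempotents
    (φ := fun i => LinearMap.toSpanSingleton R R (e i)) ⟨fun i => ?_, fun i j hij => ?_⟩⟩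
  · simpa using LinearMap.congr_fun (LinearMap.range_eq_bot.1 h) 1
  · ext
    simpa using (he.idem i).eq
  · ext
    simpa using he.ortho hij.symm

/-- Nonzero pairwise orthogonal idempotents generate independent nonzero right ideals. -/
theorem exists_iSupIndep_rightIdeals {R : Type*} [Ring R] {e : ℕ → R}
    (he : OrthogonalIdempotents e) (h0 : ∀ i, e i ≠ 0) :
    ∃ f : ℕ → Submodule Rᵐᵒᵖ R, (∀ i, f i ≠ ⊥) ∧ iSupIndep f := by
  refine ⟨_, fun i h => h0 i ?_, iSupIndep_range_of_orthogonalIdempotents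
    (φ := fun i => DistribSMul.toLinearMap Rᵐᵒᵖ R (e i)) ⟨fun i => ?_, fun i j hij => ?_⟩⟩
  · simpa using LinearMap.congr_fun (LinearMap.range_eq_bot.1 h) 1
  · refine LinearMap.ext fun m => ?_
    change e i * (e i * m) = e i * m
    rw [← mul_assoc, (he.idem i).eq]
  · refine LinearMap.ext fun m => ?_
    change e i * (e j * m) = 0
    rw [← mul_assoc, he.ortho hij, zero_mul]

/-- A ring with infinitely many nonzero pairwise orthogonal idempotents is not left Noetherian. -/
theorem not_isNoetherianRing_of_orthogonalIdempotents {R : Type*} [Ring R] {e : ℕ → R}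
    (he : OrthogonalIdempotents e) (h0 : ∀ i, e i ≠ 0) : ¬ IsNoetherianRing R := by
  intro _
  obtain ⟨f, hf, hind⟩ := exists_iSupIndep_leftIdeals he h0
  have hfin := WellFoundedGT.finite_ne_bot_of_iSupIndep hind
  simp only [ne_eq, hf, not_false_eq_true, Set.ofPred_true] at hfin
  exact Set.infinite_univ hfin

/-- If `y * x = 1`, the elements `x ^ i * (1 - x * y) * y ^ i` are orthogonal idempotents. -/
theorem orthogonalIdempotents_of_mul_eq_one {R : Type*} [Ring R] {x y : R} (h : y * x = 1) :
    OrthogonalIdempotents fun i : ℕ => x ^ i * (1 - x * y) * y ^ i := by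
  have hpow (k : ℕ) : y ^ k * x ^ k = 1 := pow_mul_pow_eq_one k h
  have hyp : y * (1 - x * y) = 0 := by rw [mul_sub, ← mul_assoc, h]; simp
  have hpx : (1 - x * y) * x = 0 := by rw [sub_mul, mul_assoc, h]; simp
  have hpp : (1 - x * y) * (1 - x * y) = 1 - x * y := by
    rw [sub_mul, one_mul, mul_assoc, hyp, mul_zero, sub_zero]
  generalize 1 - x * y = p at *
  have hmid (i j : ℕ) (hij : i ≠ j) : p * (y ^ i * x ^ j) * p = 0 := by
    rcases lt_or_gt_of_ne hij with hlt | hlt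
    · obtain ⟨k, rfl⟩ := Nat.exists_eq_add_of_lt hlt
      rw [add_assoc, pow_add, ← mul_assoc (y ^ i), hpow, one_mul, pow_succ', ← mul_assoc, hpx]
      simp
    · obtain ⟨k, rfl⟩ := Nat.exists_eq_add_of_lt hlt
      rw [add_assoc, add_comm, pow_add, mul_assoc (y ^ (k + 1)), hpow, mul_one, pow_succ,
        mul_assoc, mul_assoc, hyp]
      simp
  refine ⟨fun i => ?_, fun i j hij => ?_⟩
  · calc x ^ i * p * y ^ i * (x ^ i * p * y ^ i)
        = x ^ i * (p * (y ^ i * x ^ i) * p) * y ^ i := by simp only [mul_assoc]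
      _ = x ^ i * p * y ^ i := by rw [hpow, mul_one, hpp]
  · calc x ^ i * p * y ^ i * (x ^ j * p * y ^ j)
        = x ^ i * (p * (y ^ i * x ^ j) * p) * y ^ j := by simp only [mul_assoc]
      _ = 0 := by rw [hmid i j hij]; simp

theorem pow_mul_one_sub_mul_pow_ne_zero {R : Type*} [Ring R] {x y : R} (h : y * x = 1)
    (h' : x * y ≠ 1) (i : ℕ) : x ^ i * (1 - x * y) * y ^ i ≠ 0 := by
  have hpow (k : ℕ) : y ^ k * x ^ k = 1 := pow_mul_pow_eq_one k h
  intro h0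
  apply h'
  have : 1 - x * y = 0 := by
    calc 1 - x * y = y ^ i * x ^ i * (1 - x * y) * (y ^ i * x ^ i) := by rw [hpow]; simp
      _ = y ^ i * (x ^ i * (1 - x * y) * y ^ i) * x ^ i := by simp only [mul_assoc]
      _ = 0 := by rw [h0]; simp
  exact (sub_eq_zero.1 this).symm

theorem Yop_monomial (K : Type u) [Field K] (n : ℕ) (i : Fin n) (α : Fin n →₀ ℕ) :
    Yop K n i (monomial α 1) =
      if α i = 0 then 0 else monomial (α - Finsupp.single i 1) (1 : K) := by
  exact (basisMonomials (Fin n) K).constr_basis K _ α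

theorem Yop_mul_Xop (K : Type u) [Field K] (n : ℕ) (i : Fin n) : Yop K n i * Xop K n i = 1 := by
  refine MvPolynomial.linearMap_ext fun α => LinearMap.ext_ring ?_
  have h : Yop K n i (X i * monomial α 1) = monomial α 1 := by
    rw [X, monomial_mul, one_mul, Yop_monomial]
    simp
  exact h

theorem Xop_mul_Yop_ne_one (K : Type u) [Field K] (n : ℕ) (i : Fin n) :
    Xop K n i * Yop K n i ≠ 1 := by
  intro h
  have h1 : X i * Yop K n i (monomial 0 1) = (monomial 0 1 : PolyAlg K n) :=
    LinearMap.congr_fun h _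
  rw [Yop_monomial] at h1
  simp at h1

/-- `S_n` is neither left nor right Noetherian, and it contains an infinite direct
sum of nonzero left ideals and an infinite direct sum of nonzero right ideals. -/
theorem statement2 (K : Type u) [Field K] (n : ℕ) (hn : 0 < n) :
    ¬ IsNoetherianRing (SnAlg K n) ∧
    ¬ IsNoetherianRing (SnAlg K n)ᵐᵒᵖ ∧
    (∃ f : ℕ → Submodule (SnAlg K n) (SnAlg K n), (∀ i, f i ≠ ⊥) ∧ iSupIndep f) ∧
    (∃ f : ℕ → Submodule (SnAlg K n)ᵐᵒᵖ (SnAlg K n), (∀ i, f i ≠ ⊥) ∧ iSupIndep f) := by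
  have hyx : yS K n ⟨0, hn⟩ * xS K n ⟨0, hn⟩ = 1 := Subtype.ext (Yop_mul_Xop K n ⟨0, hn⟩)
  have hxy : xS K n ⟨0, hn⟩ * yS K n ⟨0, hn⟩ ≠ 1 := fun h =>
    Xop_mul_Yop_ne_one K n ⟨0, hn⟩ (congrArg Subtype.val h)
  have he := orthogonalIdempotents_of_mul_eq_one (R := SnAlg K n) hyx
  have h0 := pow_mul_one_sub_mul_pow_ne_zero (R := SnAlg K n) hyx hxy
  have he_op : OrthogonalIdempotents fun i => MulOpposite.op _ :=
    ⟨fun i => congrArg MulOpposite.op (he.idem i),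
      fun i j hij => congrArg MulOpposite.op (he.ortho hij.symm)⟩
  exact ⟨not_isNoetherianRing_of_orthogonalIdempotents he h0,
    not_isNoetherianRing_of_orthogonalIdempotents (R := (SnAlg K n)ᵐᵒᵖ) he_op
      fun i => (MulOpposite.op_ne_zero_iff _).2 (h0 i),
    exists_iSupIndep_leftIdeals he h0, exists_iSupIndep_rightIdeals he h0⟩
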